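/- arXiv:2501.03790 — 2 statements merged into one kernel-verified Lean document; each statement's English description precedes it below -/
import Mathlib

section
/- Let n ≥ 2, 0 < s < 1 and 0 < p,q < ∞ with sp ≥ n. Define u : ℝ^n → ℝ by u(x) = log log |x| for |x| > e and u(x) = 0 for |x| ≤ e. Then u ∈ Ẇ^{s,p}_q(ℝ^n), i.e., ∫_{ℝ^n} (∫_{ℝ^n} |u(x)−u(y)|^q / |x−y|^{n+sq} dy)^{p/q} dx < ∞. -/
open MeasureTheory Filter Set
open scoped ENNReal NNReal

noncomputable section

/-- Axis-parallel half-open cube with lower-left corner `a` and edge length `l`. -/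
def cube (n : ℕ) (a : EuclideanSpace ℝ (Fin n)) (l : ℝ) : Set (EuclideanSpace ℝ (Fin n)) :=
  {x | ∀ i, a i ≤ x i ∧ x i < a i + l}

/-- The median of `u` over a set `A`. -/
def median (n : ℕ) (u : EuclideanSpace ℝ (Fin n) → ℝ)
    (A : Set (EuclideanSpace ℝ (Fin n))) : ℝ :=
  sSup {M : ℝ | volume A / 2 ≤ volume {x ∈ A | u x < M}}

/-- The precise representative: `limsup` of medians over cubes containing `x`,
as the edge length tends to `0` from the right. -/
def preciseRep (n : ℕ) (u : EuclideanSpace ℝ (Fin n) → ℝ)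
    (x : EuclideanSpace ℝ (Fin n)) : ℝ :=
  Filter.limsup (fun al : EuclideanSpace ℝ (Fin n) × ℝ => median n u (cube n al.1 al.2))
    ((Filter.comap Prod.snd (nhdsWithin 0 (Set.Ioi 0))) ⊓
      Filter.principal {al : EuclideanSpace ℝ (Fin n) × ℝ | x ∈ cube n al.1 al.2})

/-- The `p`-th power of the homogeneous `W^{s,p}_q` seminorm. -/
def fracEnergy (n : ℕ) (s p q : ℝ) (u : EuclideanSpace ℝ (Fin n) → ℝ) : ℝ≥0∞ :=
  ∫⁻ x, (∫⁻ y, ENNReal.ofReal (|u x - u y| ^ q / ‖x - y‖ ^ ((n : ℝ) + s * q))) ^ (p / q)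

/-- Membership in the homogeneous fractional Sobolev space `Ẇ^{s,p}_q(ℝⁿ)`. -/
def MemHomFrac (n : ℕ) (s p q : ℝ) (u : EuclideanSpace ℝ (Fin n) → ℝ) : Prop :=
  Measurable u ∧ fracEnergy n s p q u < ⊤

/-- The `W^{s,p}_q` norm: `L^p` norm plus the seminorm. -/
def fracNorm (n : ℕ) (s p q : ℝ) (u : EuclideanSpace ℝ (Fin n) → ℝ) : ℝ≥0∞ :=
  eLpNorm u (ENNReal.ofReal p) volume + (fracEnergy n s p q u) ^ (1 / p)

/-- The `lam`-dimensional Hausdorff content. -/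
def hContent (n : ℕ) (lam : ℝ) (A : Set (EuclideanSpace ℝ (Fin n))) : ℝ≥0∞ :=
  ⨅ (B : ℕ → Set (EuclideanSpace ℝ (Fin n))) (_ : A ⊆ ⋃ j, B j),
    ∑' j, EMetric.diam (B j) ^ lam

/-- A set `E ⊂ ℝⁿ` is `(p,s)`-thin at infinity. -/
def ThinAtInfinity (n : ℕ) (p s : ℝ) (E : Set (EuclideanSpace ℝ (Fin n))) : Prop :=
  ∀ lam : ℝ, (n : ℝ) - s * p < lam →
    Filter.Tendsto (fun m : ℕ => hContent n lam (E \ Metric.ball 0 (m : ℝ)))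
      Filter.atTop (nhds 0)
/-- A radial profile with exponent `-a` near the origin and exponent `-b` at infinity. -/
def twoPowers (a b r : ℝ) : ℝ := if r ≤ 1 then r ^ (-a) else r ^ (-b)

lemma measurable_twoPowers (a b : ℝ) : Measurable (twoPowers a b) :=
  Measurable.ite measurableSet_Iic (by fun_prop) (by fun_prop)

lemma twoPowers_nonneg (a b : ℝ) {r : ℝ} (hr : 0 ≤ r) : 0 ≤ twoPowers a b r := by
  unfold twoPowers
  split_ifs <;> positivity

lemma pow_pred_mul_rpow {n : ℕ} (hn : 1 ≤ n) {y : ℝ} (hy : 0 < y) (c : ℝ) :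
    y ^ (n - 1) * y ^ c = y ^ ((n : ℝ) - 1 + c) := by
  rw [Real.rpow_add hy, ← Real.rpow_natCast, Nat.cast_sub hn, Nat.cast_one]

lemma integrable_twoPowers_norm {n : ℕ} (hn : 1 ≤ n) {a b : ℝ} (ha : a < n) (hb : (n : ℝ) < b) :
    Integrable (fun w : EuclideanSpace ℝ (Fin n) => twoPowers a b ‖w‖) := by
  have : Nontrivial (EuclideanSpace ℝ (Fin n)) :=
    Module.nontrivial_of_finrank_pos (R := ℝ) (by rw [finrank_euclideanSpace_fin]; omega)
  rw [integrable_fun_norm_addHaar, finrank_euclideanSpace_fin,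
    ← Ioc_union_Ioi_eq_Ioi (zero_le_one (α := ℝ)), integrableOn_union]
  constructor
  · have h : IntegrableOn (fun y : ℝ => y ^ ((n : ℝ) - 1 + -a)) (Ioc 0 1) := by
      rw [integrableOn_Ioc_iff_integrableOn_Ioo,
        intervalIntegral.integrableOn_Ioo_rpow_iff zero_lt_one]
      linarith
    refine h.congr_fun (fun y hy => ?_) measurableSet_Ioc
    simp only [twoPowers, if_pos hy.2, smul_eq_mul]
    rw [pow_pred_mul_rpow hn hy.1]
  · have h : IntegrableOn (fun y : ℝ => y ^ ((n : ℝ) - 1 + -b)) (Ioi 1) :=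
      integrableOn_Ioi_rpow_of_lt (by linarith) zero_lt_one
    refine h.congr_fun (fun y hy => ?_) measurableSet_Ioi
    simp only [twoPowers, if_neg (not_le.2 (mem_Ioi.1 hy)), smul_eq_mul]
    rw [pow_pred_mul_rpow hn (zero_lt_one.trans (mem_Ioi.1 hy))]

lemma integrableOn_Ioi_inv_mul_log_rpow {p : ℝ} (hp : 1 < p) :
    IntegrableOn (fun r : ℝ => r⁻¹ * Real.log r ^ (-p)) (Ioi (Real.exp 1)) := by
  have key : ∀ r ∈ Ici (Real.exp 1), 0 < r ∧ 1 ≤ Real.log r := fun r hr =>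
    have h : 0 < r := (Real.exp_pos 1).trans_le hr
    ⟨h, (Real.le_log_iff_exp_le h).2 hr⟩
  refine integrableOn_Ioi_deriv_of_nonneg' (g := fun r => Real.log r ^ (1 - p) / (1 - p)) (l := 0)
    (fun r hr => ?_) (fun r hr => ?_) ?_
  · obtain ⟨h0, h1⟩ := key r hr
    have := ((Real.hasDerivAt_log h0.ne').rpow_const (p := 1 - p)
      (Or.inl (by positivity))).div_const (1 - p)
    have hp' : 1 - p ≠ 0 := by linarith
    rwa [show r⁻¹ * (1 - p) * Real.log r ^ (1 - p - 1) / (1 - p) = r⁻¹ * Real.log r ^ (-p) by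
      rw [show 1 - p - 1 = -p by ring]; field_simp] at this
  · obtain ⟨h0, h1⟩ := key r (mem_Ioi.1 hr).le
    positivity
  · have h := (tendsto_rpow_neg_atTop (show 0 < p - 1 by linarith)).comp Real.tendsto_log_atTop
    have h2 := h.div_const (1 - p)
    simpa [Function.comp_def] using h2

lemma integrable_max_norm_rpow_mul_log_rpow {n : ℕ} (hn : 1 ≤ n) {p t : ℝ} (hp : 1 < p)
    (ht : (n : ℝ) ≤ t) :
    Integrable (fun x : EuclideanSpace ℝ (Fin n) =>
      Real.log (max ‖x‖ (Real.exp 1)) ^ (-p) * max ‖x‖ (Real.exp 1) ^ (-t)) := by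
  have : Nontrivial (EuclideanSpace ℝ (Fin n)) :=
    Module.nontrivial_of_finrank_pos (R := ℝ) (by rw [finrank_euclideanSpace_fin]; omega)
  rw [integrable_fun_norm_addHaar volume (f := fun r : ℝ =>
      Real.log (max r (Real.exp 1)) ^ (-p) * max r (Real.exp 1) ^ (-t)),
    finrank_euclideanSpace_fin,
    ← Ioc_union_Ioi_eq_Ioi (Real.exp_pos 1).le, integrableOn_union]
  constructor
  · have h : IntegrableOn (fun y : ℝ => y ^ (n - 1) * Real.exp 1 ^ (-t)) (Ioc 0 (Real.exp 1)) :=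
      (by fun_prop : Continuous (fun y : ℝ => y ^ (n - 1) * Real.exp 1 ^ (-t))).integrableOn_Ioc
    refine h.congr_fun (fun y hy => ?_) measurableSet_Ioc
    simp [max_eq_right hy.2]
  · refine Integrable.mono' (integrableOn_Ioi_inv_mul_log_rpow hp) (by fun_prop) ?_
    refine (ae_restrict_iff' measurableSet_Ioi).2 (Eventually.of_forall fun y hy => ?_)
    have hy0 : 0 < y := (Real.exp_pos 1).trans hy
    have hy1 : 1 ≤ y := (Real.one_le_exp zero_le_one).trans (mem_Ioi.1 hy).le
    have hl : 0 ≤ Real.log y := Real.log_nonneg hy1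
    simp only [max_eq_left (mem_Ioi.1 hy).le, smul_eq_mul]
    rw [Real.norm_of_nonneg (by positivity), mul_left_comm, pow_pred_mul_rpow hn hy0, mul_comm]
    gcongr
    rw [← Real.rpow_neg_one]
    exact Real.rpow_le_rpow_of_exponent_le hy1 (by linarith)

lemma lintegral_comp_inv_smul_euclidean {n : ℕ} {ρ : ℝ} (hρ : 0 < ρ)
    {f : EuclideanSpace ℝ (Fin n) → ℝ≥0∞} (hf : Measurable f) :
    ∫⁻ y, f (ρ⁻¹ • y) = ENNReal.ofReal (ρ ^ n) * ∫⁻ w, f w := by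
  rw [← lintegral_map hf (measurable_const_smul ρ⁻¹),
    Measure.map_addHaar_smul volume (inv_ne_zero hρ.ne'), lintegral_smul_measure,
    finrank_euclideanSpace_fin, inv_pow, inv_inv, abs_of_pos (by positivity), smul_eq_mul]

lemma abs_log_sub_log_le {a b : ℝ} (ha : 0 < a) (hb : 0 < b) :
    |Real.log a - Real.log b| ≤ |a - b| / min a b := by
  wlog h : b ≤ a generalizing a b
  · rw [abs_sub_comm, abs_sub_comm a, min_comm]
    exact this hb ha (le_of_not_ge h)
  rw [min_eq_right h, ← Real.log_div ha.ne' hb.ne',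
    abs_of_nonneg (Real.log_nonneg ((one_le_div hb).2 h)), abs_of_nonneg (sub_nonneg.2 h)]
  refine (Real.log_le_sub_one_of_pos (by positivity)).trans_eq ?_
  field_simp

lemma mul_abs_log_sub_log_le {a b : ℝ} (ha : 1 ≤ a) (hb : 1 ≤ b) :
    a * |Real.log a - Real.log b| ≤ |a - b| + |a - b| ^ 2 := by
  have h := abs_log_sub_log_le (zero_lt_one.trans_le ha) (zero_lt_one.trans_le hb)
  have hm : 1 ≤ min a b := le_min ha hb
  have ham : a ≤ min a b + |a - b| := by
    rcases le_total a b with hab | hab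
    · rw [min_eq_left hab]; linarith [abs_nonneg (a - b)]
    · rw [min_eq_right hab]; linarith [le_abs_self (a - b)]
  rw [le_div_iff₀ (by linarith)] at h
  have hl := abs_nonneg (Real.log a - Real.log b)
  have hld : |Real.log a - Real.log b| ≤ |a - b| :=
    (le_mul_of_one_le_right hl hm).trans h
  nlinarith [mul_le_mul_of_nonneg_right ham hl, mul_le_mul_of_nonneg_left hld (abs_nonneg (a - b))]

lemma add_sq_le_exp {δ d : ℝ} (hδ : 0 < δ) (hδ1 : δ ≤ 1) (hd : 0 ≤ d) :
    d + d ^ 2 ≤ 2 / δ ^ 2 * Real.exp (δ * d) := by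
  have h := Real.quadratic_le_exp_of_nonneg (mul_nonneg hδ.le hd)
  rw [div_mul_eq_mul_div, le_div_iff₀ (by positivity)]
  nlinarith [mul_nonneg (mul_nonneg hδ.le hd) (sub_nonneg.2 hδ1), mul_nonneg hδ.le hd]

lemma rpow_neg_le_twoPowers {a b τ : ℝ} (ha : 0 ≤ a) (hb : 0 ≤ b) (hτ : 1 / 2 < τ) :
    τ ^ (-b) ≤ 2 ^ b * twoPowers a b τ := by
  have h2 : (1 : ℝ) ≤ 2 ^ b := Real.one_le_rpow one_le_two hb
  have hτ0 : 0 < τ := by linarith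
  unfold twoPowers
  split_ifs with h
  · calc τ ^ (-b) ≤ (1 / 2) ^ (-b) :=
          Real.rpow_le_rpow_of_nonpos (by norm_num) hτ.le (by linarith)
      _ = 2 ^ b * 1 := by rw [one_div, Real.inv_rpow zero_le_two, ← Real.rpow_neg zero_le_two]; simp
      _ ≤ 2 ^ b * τ ^ (-a) := by
          gcongr
          exact Real.one_le_rpow_of_pos_of_le_one_of_nonpos hτ0 h (by linarith)
  · exact le_mul_of_one_le_left (by positivity) h2

lemma log_mul_abs_log_log_sub_rpow_le {q δ N a : ℝ} (hq : 0 < q) (hδ : 0 < δ) (hδ1 : δ ≤ 1)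
    (ha : δ * q ≤ a) (haN : N - q ≤ a) (hN : δ * q ≤ N)
    {ρ m t r : ℝ} (hρ : Real.exp 1 ≤ ρ) (hm : Real.exp 1 ≤ m) (ht : 0 < t) (hr : 0 < r)
    (hrm : r ≤ m) (hd : |ρ - m| ≤ t) :
    (Real.log ρ * |Real.log (Real.log ρ) - Real.log (Real.log m)|) ^ q * (t / ρ) ^ (-N) ≤
      (4 ^ q + (2 / δ ^ 2) ^ q * 3 ^ (δ * q) * 2 ^ (N - δ * q) + (2 / δ ^ 2) ^ q * 2 ^ N) *
        (twoPowers a (N - δ * q) (t / ρ) + twoPowers a (N - δ * q) (r / ρ)) := by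
  have hρ0 : 0 < ρ := (Real.exp_pos 1).trans_le hρ
  have hm0 : 0 < m := (Real.exp_pos 1).trans_le hm
  have hκ : 0 < δ * q := by positivity
  have h1ρ : 1 ≤ Real.log ρ := (Real.le_log_iff_exp_le hρ0).2 hρ
  have h1m : 1 ≤ Real.log m := (Real.le_log_iff_exp_le hm0).2 hm
  set κ := δ * q with hκdef
  set d := |Real.log ρ - Real.log m| with hddef
  set τ := t / ρ with hτdef
  set η := r / ρ with hηdef
  have hτ0 : 0 < τ := by positivity
  have hη0 : 0 < η := by positivity
  have hd0 : 0 ≤ d := abs_nonneg _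
  have hGτ := twoPowers_nonneg a (N - κ) hτ0.le
  have hGη := twoPowers_nonneg a (N - κ) hη0.le
  have hC : 0 ≤ 2 / δ ^ 2 := by positivity
  have hmain : Real.log ρ * |Real.log (Real.log ρ) - Real.log (Real.log m)| ≤ d + d ^ 2 :=
    mul_abs_log_sub_log_le h1ρ h1m
  have hL0 : 0 ≤ Real.log ρ * |Real.log (Real.log ρ) - Real.log (Real.log m)| := by positivity
  have hexp : (Real.log ρ * |Real.log (Real.log ρ) - Real.log (Real.log m)|) ^ q ≤
      (2 / δ ^ 2) ^ q * Real.exp (d * κ) := by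
    calc _ ≤ (2 / δ ^ 2 * Real.exp (δ * d)) ^ q :=
          Real.rpow_le_rpow hL0 (hmain.trans (add_sq_le_exp hδ hδ1 hd0)) hq.le
      _ = _ := by
          rw [Real.mul_rpow hC (Real.exp_pos _).le, ← Real.exp_mul, hκdef]
          ring_nf
  have hA1 : 0 ≤ (4 : ℝ) ^ q := by positivity
  have hA2 : 0 ≤ (2 / δ ^ 2) ^ q * 3 ^ κ * 2 ^ (N - κ) := by positivity
  have hA3 : 0 ≤ (2 / δ ^ 2) ^ q * 2 ^ N := by positivity
  have hNneg : 1 / 2 < τ → τ ^ (-N) ≤ 2 ^ N := fun h => by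
    calc τ ^ (-N) ≤ (1 / 2) ^ (-N) :=
          Real.rpow_le_rpow_of_nonpos (by norm_num) h.le (by linarith)
      _ = 2 ^ N := by rw [one_div, Real.inv_rpow zero_le_two, ← Real.rpow_neg zero_le_two]; simp
  rcases le_or_gt τ (1 / 2) with hτ | hτ
  · have htρ : t ≤ ρ / 2 := by rw [hτdef, div_le_iff₀ hρ0] at hτ; linarith
    have hmin : ρ / 2 ≤ min ρ m := le_min (by linarith) (by linarith [(abs_le.1 hd).2])
    have hdτ : d ≤ 2 * τ := by
      calc d ≤ |ρ - m| / min ρ m := abs_log_sub_log_le hρ0 hm0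
        _ ≤ t / (ρ / 2) := by gcongr
        _ = 2 * τ := by rw [hτdef]; field_simp
    have hle : (Real.log ρ * |Real.log (Real.log ρ) - Real.log (Real.log m)|) ^ q * τ ^ (-N) ≤
        4 ^ q * twoPowers a (N - κ) τ := by
      calc _ ≤ (4 * τ) ^ q * τ ^ (-N) := by
            refine mul_le_mul_of_nonneg_right
              (Real.rpow_le_rpow hL0 (hmain.trans ?_) hq.le) (by positivity)
            nlinarith
        _ = 4 ^ q * τ ^ (q + -N) := by
            rw [Real.mul_rpow (by norm_num) hτ0.le, Real.rpow_add hτ0, mul_assoc]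
        _ ≤ 4 ^ q * twoPowers a (N - κ) τ := by
            rw [twoPowers, if_pos (by linarith)]
            gcongr 4 ^ q * ?_
            exact Real.rpow_le_rpow_of_exponent_ge hτ0 (by linarith) (by linarith)
    exact hle.trans (mul_le_mul (by linarith) (by linarith) hGτ (by linarith))
  rcases le_or_gt ρ m with hρm | hρm
  · have hdm : Real.exp (d * κ) = (m / ρ) ^ κ := by
      rw [hddef, abs_sub_comm, abs_of_nonneg (sub_nonneg.2 (Real.log_le_log hρ0 hρm)),
        ← Real.log_div hm0.ne' hρ0.ne', Real.rpow_def_of_pos (by positivity)]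
    have hm3 : m / ρ ≤ 3 * τ := by
      have : ρ < 2 * t := by rw [hτdef, lt_div_iff₀ hρ0] at hτ; linarith
      rw [hτdef, ← mul_div_assoc]
      gcongr
      linarith [(abs_le.1 hd).1]
    have hle : (Real.log ρ * |Real.log (Real.log ρ) - Real.log (Real.log m)|) ^ q * τ ^ (-N) ≤
        (2 / δ ^ 2) ^ q * 3 ^ κ * 2 ^ (N - κ) * twoPowers a (N - κ) τ := by
      calc _ ≤ (2 / δ ^ 2) ^ q * (3 * τ) ^ κ * τ ^ (-N) := by
            gcongr
            refine hexp.trans ?_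
            rw [hdm]
            gcongr
        _ = (2 / δ ^ 2) ^ q * 3 ^ κ * τ ^ (-(N - κ)) := by
            rw [Real.mul_rpow (by norm_num) hτ0.le, show -(N - κ) = κ + -N by ring,
              Real.rpow_add hτ0]
            ring
        _ ≤ (2 / δ ^ 2) ^ q * 3 ^ κ * (2 ^ (N - κ) * twoPowers a (N - κ) τ) := by
            gcongr
            exact rpow_neg_le_twoPowers (by linarith) (by linarith) hτ
        _ = _ := by ring
    exact hle.trans (mul_le_mul (by linarith) (by linarith) hGτ (by linarith))
  · have hdm : Real.exp (d * κ) = (m / ρ) ^ (-κ) := by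
      rw [hddef, abs_of_nonneg (sub_nonneg.2 (Real.log_le_log hm0 hρm.le)),
        Real.rpow_def_of_pos (by positivity), Real.log_div hm0.ne' hρ0.ne']
      ring_nf
    have hη1 : η ≤ 1 := (div_le_one hρ0).2 (hrm.trans hρm.le)
    have hle : (Real.log ρ * |Real.log (Real.log ρ) - Real.log (Real.log m)|) ^ q * τ ^ (-N) ≤
        (2 / δ ^ 2) ^ q * 2 ^ N * twoPowers a (N - κ) η := by
      calc _ ≤ (2 / δ ^ 2) ^ q * η ^ (-a) * 2 ^ N := by
            gcongr
            · refine hexp.trans ?_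
              rw [hdm]
              gcongr
              calc (m / ρ) ^ (-κ) ≤ η ^ (-κ) :=
                    Real.rpow_le_rpow_of_nonpos hη0 (by rw [hηdef]; gcongr) (by linarith)
                _ ≤ η ^ (-a) := Real.rpow_le_rpow_of_exponent_ge hη0 hη1 (by linarith)
            · exact hNneg hτ
        _ = _ := by rw [twoPowers, if_pos hη1]; ring
    exact hle.trans (mul_le_mul (by linarith) (by linarith) hGη (by linarith))

lemma exists_lintegral_loglog_le {n : ℕ} (hn : 2 ≤ n) {s q : ℝ} (hs0 : 0 < s) (hs1 : s < 1)
    (hq : 0 < q) (u : EuclideanSpace ℝ (Fin n) → ℝ)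
    (hu : ∀ x, u x = Real.log (Real.log (max ‖x‖ (Real.exp 1)))) :
    ∃ K : ℝ≥0∞, K ≠ ⊤ ∧ ∀ x,
      ∫⁻ y, ENNReal.ofReal (|u x - u y| ^ q / ‖x - y‖ ^ ((n : ℝ) + s * q)) ≤
        K * ENNReal.ofReal (Real.log (max ‖x‖ (Real.exp 1)) ^ (-q) *
          max ‖x‖ (Real.exp 1) ^ (-(s * q))) := by
  have : Nontrivial (EuclideanSpace ℝ (Fin n)) :=
    Module.nontrivial_of_finrank_pos (R := ℝ) (by rw [finrank_euclideanSpace_fin]; omega)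
  have hn2 : (2 : ℝ) ≤ n := by exact_mod_cast hn
  have hsq : 0 < s * q := by positivity
  set δ := min (s / 2) (1 / q) with hδdef
  have hδ : 0 < δ := by positivity
  have hδs : δ ≤ s / 2 := min_le_left _ _
  have hκ1 : δ * q ≤ 1 := (le_div_iff₀ hq).1 (min_le_right _ _)
  have hκs : δ * q < s * q := by gcongr; linarith
  set N := (n : ℝ) + s * q with hNdef
  set a := max (N - q) 1 with hadef
  have han : a < n := max_lt (by nlinarith) (by linarith)
  set b := N - δ * q with hbdef
  have hbn : (n : ℝ) < b := by linarith
  set A := (4 : ℝ) ^ q + (2 / δ ^ 2) ^ q * 3 ^ (δ * q) * 2 ^ (N - δ * q) + (2 / δ ^ 2) ^ q * 2 ^ N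
    with hAdef
  have hA : 0 ≤ A := by positivity
  set G : EuclideanSpace ℝ (Fin n) → ℝ≥0∞ := fun w => ENNReal.ofReal (twoPowers a b ‖w‖)
    with hGdef
  have hG : Measurable G := ((measurable_twoPowers a b).comp measurable_norm).ennreal_ofReal
  have hGfin : ∫⁻ w, G w ≠ ⊤ :=
    (integrable_twoPowers_norm (by omega) han hbn).lintegral_lt_top.ne
  refine ⟨ENNReal.ofReal A * (2 * ∫⁻ w, G w), by finiteness, fun x => ?_⟩
  set ρ := max ‖x‖ (Real.exp 1) with hρdef
  have hρ : Real.exp 1 ≤ ρ := le_max_right _ _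
  have hρ0 : 0 < ρ := (Real.exp_pos 1).trans_le hρ
  have hL : 0 < Real.log ρ := zero_lt_one.trans_le ((Real.le_log_iff_exp_le hρ0).2 hρ)
  have hpt : ∀ᵐ y, ENNReal.ofReal (|u x - u y| ^ q / ‖x - y‖ ^ N) ≤
      ENNReal.ofReal (A * (Real.log ρ ^ (-q) * ρ ^ (-N))) *
        (G (ρ⁻¹ • (x - y)) + G (ρ⁻¹ • y)) := by
    filter_upwards [Measure.ae_ne volume x, Measure.ae_ne volume 0] with y hyx hy0
    have ht : 0 < ‖x - y‖ := norm_pos_iff.2 (sub_ne_zero.2 hyx.symm)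
    have hr : 0 < ‖y‖ := norm_pos_iff.2 hy0
    have hd : |ρ - max ‖y‖ (Real.exp 1)| ≤ ‖x - y‖ :=
      (abs_max_sub_max_le_abs _ _ _).trans (abs_norm_sub_norm_le x y)
    have key := log_mul_abs_log_log_sub_rpow_le hq hδ (by linarith : δ ≤ 1)
      (hκ1.trans (le_max_right _ _)) (le_max_left _ _) (by linarith : δ * q ≤ N)
      hρ (le_max_right ‖y‖ _) ht hr (le_max_left _ _) hd
    have hn1 : ∀ w : EuclideanSpace ℝ (Fin n), ‖ρ⁻¹ • w‖ = ‖w‖ / ρ := fun w => by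
      rw [norm_smul, norm_inv, Real.norm_of_nonneg hρ0.le, div_eq_inv_mul]
    simp only [hGdef, hn1]
    rw [← ENNReal.ofReal_add (twoPowers_nonneg _ _ (by positivity))
      (twoPowers_nonneg _ _ (by positivity)), ← ENNReal.ofReal_mul (by positivity)]
    refine ENNReal.ofReal_le_ofReal ?_
    rw [hu x, hu y, ← hρdef]
    calc _ = Real.log ρ ^ (-q) * ρ ^ (-N) *
          ((Real.log ρ * |Real.log (Real.log ρ) - Real.log (Real.log (max ‖y‖ (Real.exp 1)))|) ^ q *
            (‖x - y‖ / ρ) ^ (-N)) := by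
          rw [Real.mul_rpow hL.le (abs_nonneg _), Real.div_rpow ht.le hρ0.le,
            Real.rpow_neg hL.le, Real.rpow_neg ht.le]
          have := Real.rpow_pos_of_pos hL q
          have := Real.rpow_pos_of_pos hρ0 (-N)
          field_simp
      _ ≤ Real.log ρ ^ (-q) * ρ ^ (-N) *
          (A * (twoPowers a b (‖x - y‖ / ρ) + twoPowers a b (‖y‖ / ρ))) := by gcongr
      _ = _ := by ring
  have hGρ : Measurable fun y => G (ρ⁻¹ • y) := hG.comp (measurable_const_smul _)
  have hsub : ∫⁻ y, G (ρ⁻¹ • (x - y)) = ∫⁻ y, G (ρ⁻¹ • y) :=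
    lintegral_sub_left_eq_self (fun z => G (ρ⁻¹ • z)) x
  calc _ ≤ ∫⁻ y, ENNReal.ofReal (A * (Real.log ρ ^ (-q) * ρ ^ (-N))) *
        (G (ρ⁻¹ • (x - y)) + G (ρ⁻¹ • y)) := lintegral_mono_ae hpt
    _ = ENNReal.ofReal (A * (Real.log ρ ^ (-q) * ρ ^ (-N))) *
        (2 * (ENNReal.ofReal (ρ ^ n) * ∫⁻ w, G w)) := by
        rw [lintegral_const_mul' _ _ ENNReal.ofReal_ne_top,
          lintegral_add_right _ hGρ, hsub,
          lintegral_comp_inv_smul_euclidean hρ0 hG, two_mul]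
    _ = ENNReal.ofReal (A * (Real.log ρ ^ (-q) * ρ ^ (-N)) * ρ ^ n) * (2 * ∫⁻ w, G w) := by
        rw [ENNReal.ofReal_mul (p := A * (Real.log ρ ^ (-q) * ρ ^ (-N))) (by positivity)]
        ring
    _ = ENNReal.ofReal A * (2 * ∫⁻ w, G w) *
        ENNReal.ofReal (Real.log ρ ^ (-q) * ρ ^ (-(s * q))) := by
        have : A * (Real.log ρ ^ (-q) * ρ ^ (-N)) * ρ ^ n =
            A * (Real.log ρ ^ (-q) * ρ ^ (-(s * q))) := by
          rw [mul_assoc, mul_assoc, ← Real.rpow_natCast ρ n, ← Real.rpow_add hρ0, hNdef]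
          ring_nf
        rw [this, ENNReal.ofReal_mul hA]
        ring

theorem stmt8 (n : ℕ) (hn : 2 ≤ n) (s p q : ℝ) (hs0 : 0 < s) (hs1 : s < 1)
    (hp : 0 < p) (hq : 0 < q) (hspn : (n : ℝ) ≤ s * p)
    (u : EuclideanSpace ℝ (Fin n) → ℝ)
    (hu : u = fun x => if Real.exp 1 < ‖x‖ then Real.log (Real.log ‖x‖) else 0) :
    fracEnergy n s p q u < ⊤ := by
  have hn2 : (2 : ℝ) ≤ n := by exact_mod_cast hn
  have hu' : ∀ x, u x = Real.log (Real.log (max ‖x‖ (Real.exp 1))) := fun x => by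
    simp only [hu]
    split_ifs with h
    · rw [max_eq_left h.le]
    · rw [max_eq_right (not_lt.1 h)]; simp
  obtain ⟨K, hK, hle⟩ := exists_lintegral_loglog_le hn hs0 hs1 hq u hu'
  have hpq : 0 ≤ p / q := by positivity
  have hfin := (integrable_max_norm_rpow_mul_log_rpow (n := n) (p := p) (t := s * p) (by omega)
    (by nlinarith) hspn).lintegral_lt_top
  have hKpq : K ^ (p / q) ≠ ⊤ := ENNReal.rpow_ne_top_of_nonneg hpq hK
  calc fracEnergy n s p q u ≤ ∫⁻ x, K ^ (p / q) * ENNReal.ofReal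
        (Real.log (max ‖x‖ (Real.exp 1)) ^ (-p) * max ‖x‖ (Real.exp 1) ^ (-(s * p))) := by
        refine lintegral_mono fun x => ?_
        refine (ENNReal.rpow_le_rpow (hle x) hpq).trans_eq ?_
        have hρ0 : 0 < max ‖x‖ (Real.exp 1) := lt_max_of_lt_right (Real.exp_pos 1)
        have hL : 0 ≤ Real.log (max ‖x‖ (Real.exp 1)) := zero_le_one.trans
          ((Real.le_log_iff_exp_le hρ0).2 (le_max_right _ _))
        rw [ENNReal.mul_rpow_of_nonneg _ _ hpq, ENNReal.ofReal_rpow_of_nonneg (by positivity) hpq,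
          Real.mul_rpow (by positivity) (by positivity), ← Real.rpow_mul hL,
          ← Real.rpow_mul hρ0.le, show -q * (p / q) = -p by field_simp,
          show -(s * q) * (p / q) = -(s * p) by field_simp]
    _ < ⊤ := by
        rw [lintegral_const_mul' _ _ hKpq]
        exact ENNReal.mul_lt_top hKpq.lt_top hfin

end
end

section
/- Let n ≥ 2, 0 < s < 1 and 0 < p,q < ∞ with sp ≥ n. Then there exists a bounded continuous function u ∈ Ẇ^{s,p}_q(ℝ^n) such that there is no continuous curve γ : [0,∞) → ℝ^n with γ(0) = 0 and |γ(t)| → ∞ as t → ∞ for which the limit lim_{t→∞} u(γ(t)) exists. -/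
open MeasureTheory Filter Set
open scoped ENNReal NNReal

noncomputable section

lemma lintegral_fun_norm_eq {n : ℕ} (hn : 1 ≤ n) {f g : ℝ → ℝ} (hf : ∀ t, 0 ≤ t → 0 ≤ f t)
    (hfg : ∀ t, 0 < t → t ^ (n - 1) * f t = g t) (hg : IntegrableOn g (Ioi 0)) :
    ∫⁻ x : EuclideanSpace ℝ (Fin n), ENNReal.ofReal (f ‖x‖) =
      ENNReal.ofReal (n * volume.real (Metric.ball (0 : EuclideanSpace ℝ (Fin n)) 1) *
        ∫ t in Ioi 0, g t) := by
  have : Nonempty (Fin n) := ⟨⟨0, hn⟩⟩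
  have hcongr : EqOn (fun t : ℝ => t ^ (n - 1) • f t) g (Ioi 0) := fun t ht => hfg t ht
  have hfint : Integrable (fun x : EuclideanSpace ℝ (Fin n) => f ‖x‖) := by
    rw [integrable_fun_norm_addHaar, finrank_euclideanSpace_fin]
    exact hg.congr_fun hcongr.symm measurableSet_Ioi
  rw [← ofReal_integral_eq_lintegral_ofReal hfint
    (Eventually.of_forall fun x => hf _ (norm_nonneg x)), integral_fun_norm_addHaar,
    finrank_euclideanSpace_fin, setIntegral_congr_fun measurableSet_Ioi hcongr]
  simp [mul_assoc]

lemma pow_pred_mul_rpow_s9 {n : ℕ} (hn : 1 ≤ n) {t : ℝ} (ht : 0 < t) (b : ℝ) :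
    t ^ (n - 1) * t ^ (b - n) = t ^ (b - 1) := by
  rw [← Real.rpow_natCast, ← Real.rpow_add ht, Nat.cast_sub hn]
  congr 1
  push_cast
  ring

lemma exists_lintegral_ball_rpow_le {n : ℕ} (hn : 1 ≤ n) {b : ℝ} (hb : 0 < b) :
    ∃ K : ℝ, 0 ≤ K ∧ ∀ ρ : ℝ, 0 < ρ →
      ∫⁻ x : EuclideanSpace ℝ (Fin n),
        ENNReal.ofReal ((Iic ρ).indicator (fun t => t ^ (b - n)) ‖x‖) ≤
          ENNReal.ofReal (K * ρ ^ b) := by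
  refine ⟨n * volume.real (Metric.ball (0 : EuclideanSpace ℝ (Fin n)) 1) * b⁻¹, by positivity,
    fun ρ hρ => ?_⟩
  have hset : Iic ρ ∩ Ioi 0 = Ioc 0 ρ := by ext; simp [and_comm]
  rw [lintegral_fun_norm_eq hn (g := (Iic ρ).indicator fun t => t ^ (b - 1))]
  · rw [setIntegral_indicator measurableSet_Iic, inter_comm, hset,
      ← intervalIntegral.integral_of_le hρ.le, integral_rpow (Or.inl (by linarith))]
    simp only [sub_add_cancel, Real.zero_rpow hb.ne', sub_zero]
    apply le_of_eq
    congr 1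
    ring
  · intro t ht
    exact indicator_apply_nonneg fun _ => Real.rpow_nonneg ht _
  · intro t ht
    by_cases h : t ∈ Iic ρ
    · simp only [indicator_of_mem h, pow_pred_mul_rpow_s9 hn ht]
    · simp [indicator_of_notMem h]
  · rw [IntegrableOn, integrable_indicator_iff measurableSet_Iic, IntegrableOn,
      Measure.restrict_restrict measurableSet_Iic, hset]
    exact ((intervalIntegral.intervalIntegrable_rpow' (by linarith)).1)

lemma exists_lintegral_compl_ball_rpow_le {n : ℕ} (hn : 1 ≤ n) {b : ℝ} (hb : 0 < b) :
    ∃ K : ℝ, 0 ≤ K ∧ ∀ ρ : ℝ, 0 < ρ →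
      ∫⁻ x : EuclideanSpace ℝ (Fin n),
        ENNReal.ofReal ((Ioi ρ).indicator (fun t => t ^ (-b - n)) ‖x‖) ≤
          ENNReal.ofReal (K * ρ ^ (-b)) := by
  refine ⟨n * volume.real (Metric.ball (0 : EuclideanSpace ℝ (Fin n)) 1) * b⁻¹, by positivity,
    fun ρ hρ => ?_⟩
  have hset : Ioi ρ ∩ Ioi 0 = Ioi ρ := by
    rw [Ioi_inter_Ioi, sup_eq_left.2 hρ.le]
  rw [lintegral_fun_norm_eq hn (g := (Ioi ρ).indicator fun t => t ^ (-b - 1))]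
  · rw [setIntegral_indicator measurableSet_Ioi, inter_comm, hset,
      integral_Ioi_rpow_of_lt (by linarith) hρ]
    apply le_of_eq
    congr 1
    rw [sub_add_cancel]
    field_simp
  · intro t ht
    exact indicator_apply_nonneg fun _ => Real.rpow_nonneg ht _
  · intro t ht
    by_cases h : t ∈ Ioi ρ
    · simp only [indicator_of_mem h, pow_pred_mul_rpow_s9 hn ht]
    · simp [indicator_of_notMem h]
  · rw [IntegrableOn, integrable_indicator_iff measurableSet_Ioi, IntegrableOn,
      Measure.restrict_restrict measurableSet_Ioi, hset]
    exact integrableOn_Ioi_rpow_of_lt (by linarith) hρ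

lemma integrableOn_inv_mul_log_rpow {p : ℝ} (hp : 1 < p) :
    IntegrableOn (fun t : ℝ => (Real.exp 1 + t)⁻¹ * Real.log (Real.exp 1 + t) ^ (-p)) (Ioi 0) := by
  have hlog : ∀ t : ℝ, 0 ≤ t → 0 < Real.log (Real.exp 1 + t) := fun t ht => by
    apply Real.log_pos
    have := Real.add_one_le_exp (1 : ℝ)
    linarith
  have hpos : ∀ t : ℝ, 0 ≤ t → 0 < Real.exp 1 + t := fun t ht => by positivity
  refine integrableOn_Ioi_deriv_of_nonneg' (l := 0)
    (g := fun t => (1 - p)⁻¹ * Real.log (Real.exp 1 + t) ^ (1 - p)) (fun t ht => ?_)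
    (fun t ht => ?_) ?_
  · have h1 : HasDerivAt (fun t : ℝ => Real.exp 1 + t) 1 t := (hasDerivAt_id t).const_add _
    have h2 := ((h1.log (hpos t ht).ne').rpow_const (p := 1 - p)
      (Or.inl (hlog t ht).ne')).const_mul (1 - p)⁻¹
    refine h2.congr_deriv ?_
    have h3 : (1 - p) ≠ 0 := by linarith
    rw [show 1 - p - 1 = -p by ring]
    field_simp
  · have := hlog t (le_of_lt ht)
    have := hpos t (le_of_lt ht)
    positivity
  · have h : Tendsto (fun t : ℝ => Real.log (Real.exp 1 + t)) atTop atTop :=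
      Real.tendsto_log_atTop.comp (tendsto_atTop_add_const_left _ _ tendsto_id)
    have h2 := ((tendsto_rpow_neg_atTop (y := p - 1) (by linarith)).comp h).const_mul (1 - p)⁻¹
    simpa using h2

lemma lintegral_log_weight_lt_top {n : ℕ} (hn : 1 ≤ n) {p : ℝ} (hp : 1 < p) :
    ∫⁻ x : EuclideanSpace ℝ (Fin n), ENNReal.ofReal
      ((Real.exp 1 + ‖x‖) ^ (-(n : ℝ)) * Real.log (Real.exp 1 + ‖x‖) ^ (-p)) < ⊤ := by
  have hlog : ∀ t : ℝ, 0 ≤ t → 0 ≤ Real.log (Real.exp 1 + t) := fun t ht => by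
    apply Real.log_nonneg
    have := Real.add_one_le_exp (1 : ℝ)
    linarith
  have hbase := integrableOn_inv_mul_log_rpow hp
  rw [lintegral_fun_norm_eq hn
    (f := fun t => (Real.exp 1 + t) ^ (-(n : ℝ)) * Real.log (Real.exp 1 + t) ^ (-p))
    (g := fun t => t ^ (n - 1) *
      ((Real.exp 1 + t) ^ (-(n : ℝ)) * Real.log (Real.exp 1 + t) ^ (-p)))]
  · exact ENNReal.ofReal_lt_top
  · intro t ht
    have := hlog t ht
    positivity
  · intro t ht
    rfl
  · refine hbase.mono' (Measurable.aestronglyMeasurable (by fun_prop)) ?_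
    refine (ae_restrict_iff' measurableSet_Ioi).2 (Eventually.of_forall fun t (ht : 0 < t) => ?_)
    have := hlog t ht.le
    have hr : 0 < Real.exp 1 + t := by positivity
    rw [Real.norm_of_nonneg (by positivity), ← mul_assoc]
    gcongr
    calc t ^ (n - 1) * (Real.exp 1 + t) ^ (-(n : ℝ))
        ≤ (Real.exp 1 + t) ^ (n - 1) * (Real.exp 1 + t) ^ ((0 : ℝ) - n) := by
          rw [zero_sub]
          gcongr
          linarith [Real.exp_pos 1]
      _ = (Real.exp 1 + t)⁻¹ := by
          rw [pow_pred_mul_rpow_s9 hn hr, zero_sub, Real.rpow_neg_one]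

lemma log_sub_log_le_div {a b : ℝ} (ha : 0 < a) (hb : 0 < b) :
    Real.log b - Real.log a ≤ (b - a) / a := by
  rw [← Real.log_div hb.ne' ha.ne', sub_div, div_self ha.ne']
  exact Real.log_le_sub_one_of_pos (by positivity)

lemma one_le_log_of_exp_one_le {r : ℝ} (hr : Real.exp 1 ≤ r) : 1 ≤ Real.log r :=
  (Real.le_log_iff_exp_le ((Real.exp_pos 1).trans_le hr)).2 hr

lemma abs_log_log_sub_le_of_near {r r' t : ℝ} (hr : Real.exp 1 ≤ r) (hr' : Real.exp 1 ≤ r')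
    (ht : |r - r'| ≤ t) (htr : t ≤ r / 2) :
    |Real.log (Real.log r) - Real.log (Real.log r')| ≤ 8 / Real.log r * (t / r) := by
  have hr0 : 0 < r := (Real.exp_pos 1).trans_le hr
  have hr0' : 0 < r' := (Real.exp_pos 1).trans_le hr'
  have hL := one_le_log_of_exp_one_le hr
  have hL' := one_le_log_of_exp_one_le hr'
  have ht0 : 0 ≤ t := (abs_nonneg _).trans ht
  obtain ⟨h1, h2⟩ := abs_le.1 ht
  have hd1 : Real.log r - Real.log r' ≤ 2 * (t / r) := by
    refine (log_sub_log_le_div hr0' hr0).trans ?_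
    rw [← mul_div_assoc, div_le_div_iff₀ hr0' hr0]
    nlinarith
  have hd2 : Real.log r' - Real.log r ≤ 2 * (t / r) := by
    refine (log_sub_log_le_div hr0 hr0').trans ?_
    rw [← mul_div_assoc]
    gcongr
    linarith
  have hquarter : Real.log r / 4 ≤ Real.log r' := by
    have : Real.log (r / 2) ≤ Real.log r' := Real.log_le_log (by positivity) (by linarith)
    rw [Real.log_div hr0.ne' two_ne_zero] at this
    have := Real.log_two_lt_d9
    linarith
  have hw : 0 ≤ t / r := by positivity
  rw [abs_le']
  constructor
  · refine (log_sub_log_le_div (by linarith) (by linarith)).trans ?_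
    calc (Real.log r - Real.log r') / Real.log r'
        ≤ 2 * (t / r) / Real.log r' := by gcongr
      _ ≤ 2 * (t / r) / (Real.log r / 4) := by gcongr
      _ = 8 / Real.log r * (t / r) := by field_simp; ring
  · rw [neg_sub]
    refine (log_sub_log_le_div (by linarith) (by linarith)).trans ?_
    calc (Real.log r' - Real.log r) / Real.log r
        ≤ 2 * (t / r) / Real.log r := by gcongr
      _ ≤ 8 * (t / r) / Real.log r := by gcongr; norm_num
      _ = 8 / Real.log r * (t / r) := by ring

lemma abs_log_log_sub_le_of_le {r r' t ε : ℝ} (hr : Real.exp 1 ≤ r) (hrr' : r ≤ r')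
    (ht : |r - r'| ≤ t) (htr : r / 2 < t) (hε : 0 < ε) :
    |Real.log (Real.log r) - Real.log (Real.log r')| ≤
      (3 ^ ε / ε) / Real.log r * (t / r) ^ ε := by
  have hr0 : 0 < r := (Real.exp_pos 1).trans_le hr
  have hr0' : 0 < r' := hr0.trans_le hrr'
  have hL := one_le_log_of_exp_one_le hr
  have hLL : Real.log r ≤ Real.log r' := Real.log_le_log hr0 hrr'
  have ht0 : 0 ≤ t := (abs_nonneg _).trans ht
  obtain ⟨h1, -⟩ := abs_le.1 ht
  have hlog : Real.log r' - Real.log r ≤ 3 ^ ε * (t / r) ^ ε / ε := by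
    rw [← Real.log_div hr0'.ne' hr0.ne', ← Real.mul_rpow (by norm_num) (by positivity)]
    refine (Real.log_le_rpow_div (by positivity) hε).trans ?_
    gcongr
    rw [← mul_div_assoc]
    gcongr
    linarith
  rw [abs_sub_comm, abs_of_nonneg (sub_nonneg.2 (Real.log_le_log (by linarith) hLL))]
  refine (log_sub_log_le_div (by linarith) (by linarith)).trans ?_
  calc (Real.log r' - Real.log r) / Real.log r
      ≤ 3 ^ ε * (t / r) ^ ε / ε / Real.log r := by gcongr
    _ = (3 ^ ε / ε) / Real.log r * (t / r) ^ ε := by ring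

lemma abs_log_log_sub_le_of_ge {r r' ε : ℝ} (hr' : Real.exp 1 ≤ r') (hrr' : r' ≤ r)
    (hε : 0 < ε) :
    |Real.log (Real.log r) - Real.log (Real.log r')| ≤
      (2 / ε * (1 + 2 / ε)) / Real.log r * (r / r') ^ ε := by
  have hr0' : 0 < r' := (Real.exp_pos 1).trans_le hr'
  have hr0 : 0 < r := hr0'.trans_le hrr'
  have hL' := one_le_log_of_exp_one_le hr'
  have hLL : Real.log r' ≤ Real.log r := Real.log_le_log hr0' hrr'
  set L := Real.log r
  set L' := Real.log r'
  set W := (r / r') ^ (ε / 2) with hW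
  have hW1 : 1 ≤ W := Real.one_le_rpow ((one_le_div hr0').2 hrr') (by positivity)
  have hd : L - L' ≤ 2 / ε * W := by
    rw [← Real.log_div hr0.ne' hr0'.ne']
    refine (Real.log_le_rpow_div (by positivity) (half_pos hε)).trans (le_of_eq ?_)
    rw [← hW]
    field_simp
  have hratio : L / L' ≤ (1 + 2 / ε) * W := by
    have : L / L' = 1 + (L - L') / L' := by field_simp; ring
    rw [this]
    have : (L - L') / L' ≤ L - L' := div_le_self (by linarith) hL'
    linarith
  have hWW : W * W = (r / r') ^ ε := by
    rw [hW, ← Real.rpow_add (by positivity), add_halves]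
  rw [abs_of_nonneg (sub_nonneg.2 (Real.log_le_log (by linarith) hLL))]
  refine (log_sub_log_le_div (by linarith) (by linarith)).trans ?_
  have hL : 0 < L := by linarith
  calc (L - L') / L' = (L - L') * (L / L') / L := by field_simp
    _ ≤ (2 / ε * W) * ((1 + 2 / ε) * W) / L := by
        gcongr
    _ = (2 / ε * (1 + 2 / ε)) / L * (W * W) := by ring
    _ = _ := by rw [hWW]

/-- A bounded radial function oscillating at infinity on a doubly logarithmic scale. -/
def slowOsc (n : ℕ) (x : EuclideanSpace ℝ (Fin n)) : ℝ :=
  Real.sin (Real.log (Real.log (Real.exp 1 + ‖x‖)))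

lemma continuous_log_log_add_norm (n : ℕ) :
    Continuous fun x : EuclideanSpace ℝ (Fin n) => Real.log (Real.log (Real.exp 1 + ‖x‖)) := by
  have h : ∀ x : EuclideanSpace ℝ (Fin n), 1 ≤ Real.log (Real.exp 1 + ‖x‖) := fun x =>
    one_le_log_of_exp_one_le (by linarith [norm_nonneg x])
  refine Continuous.log (Continuous.log (by fun_prop) fun x => ?_) fun x => ?_
  · positivity
  · linarith [h x]

lemma continuous_slowOsc (n : ℕ) : Continuous (slowOsc n) :=
  Real.continuous_sin.comp (continuous_log_log_add_norm n)

lemma slowOsc_quotient_le {n : ℕ} {s q ε : ℝ} (hs : 0 < s) (hq : 0 < q) (hε : 0 < ε)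
    {x y : EuclideanSpace ℝ (Fin n)} {r : ℝ} (hr : r = Real.exp 1 + ‖x‖) (hy : y ≠ 0) :
    |slowOsc n x - slowOsc n y| ^ q / ‖x - y‖ ^ ((n : ℝ) + s * q) ≤
      ((8 + 3 ^ ε / ε + 2 / ε * (1 + 2 / ε)) / Real.log r) ^ q *
        (r ^ (-q) * (Iic (r / 2)).indicator (fun t => t ^ (q * (1 - s) - n)) ‖x - y‖ +
         r ^ (-(ε * q)) *
          (Ioi (r / 2)).indicator (fun t => t ^ (-((s - ε) * q) - n)) ‖x - y‖ +
         2 ^ (n + s * q) * r ^ (ε * q - n - s * q) *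
          (Iic r).indicator (fun t => t ^ ((n - ε * q) - n)) ‖y‖) := by
  have hxr : ‖x‖ ≤ r := by linarith [Real.exp_pos 1]
  have her : Real.exp 1 ≤ r := by linarith [norm_nonneg x]
  have hr0 : 0 < r := (Real.exp_pos 1).trans_le her
  have hL := one_le_log_of_exp_one_le her
  set L := Real.log r with hLdef
  have hL0 : 0 < L := by linarith
  set M := 8 + 3 ^ ε / ε + 2 / ε * (1 + 2 / ε) with hM
  have hA1 : 0 < (3 : ℝ) ^ ε / ε := by positivity
  have hA2 : 0 < 2 / ε * (1 + 2 / ε) := by positivity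
  have hM1 : 8 ≤ M := by linarith
  have hM2 : 3 ^ ε / ε ≤ M := by linarith
  have hM3 : 2 / ε * (1 + 2 / ε) ≤ M := by linarith
  have hM0 : 0 ≤ M := by linarith
  have hI1 : 0 ≤ (Iic (r / 2)).indicator (fun t => t ^ (q * (1 - s) - n)) ‖x - y‖ :=
    indicator_apply_nonneg fun _ => by positivity
  have hI2 : 0 ≤ (Ioi (r / 2)).indicator (fun t => t ^ (-((s - ε) * q) - n)) ‖x - y‖ :=
    indicator_apply_nonneg fun _ => by positivity
  have hI3 : 0 ≤ (Iic r).indicator (fun t => t ^ ((n - ε * q) - n)) ‖y‖ :=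
    indicator_apply_nonneg fun _ => by positivity
  rcases eq_or_ne x y with rfl | hxy
  · rw [sub_self (slowOsc n x), abs_zero, Real.zero_rpow hq.ne', zero_div]
    positivity
  have ht0 : 0 < ‖x - y‖ := norm_pos_iff.2 (sub_ne_zero.2 hxy)
  have hy0 : 0 < ‖y‖ := norm_pos_iff.2 hy
  set t := ‖x - y‖ with htdef
  set r' := Real.exp 1 + ‖y‖ with hr'def
  have her' : Real.exp 1 ≤ r' := by linarith
  have hr0' : 0 < r' := (Real.exp_pos 1).trans_le her'
  have hrt : |r - r'| ≤ t := by
    rw [hr, hr'def, add_sub_add_left_eq_sub]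
    exact abs_norm_sub_norm_le x y
  have hD : |slowOsc n x - slowOsc n y| ≤ |Real.log L - Real.log (Real.log r')| := by
    simp only [slowOsc, ← hr, ← hr'def, ← hLdef]
    exact Real.abs_sin_sub_sin_le _ _
  have key : ∀ w : ℝ, 0 ≤ w → |Real.log L - Real.log (Real.log r')| ≤ M / L * w →
      |slowOsc n x - slowOsc n y| ^ q ≤ (M / L) ^ q * w ^ q := fun w hw h => by
    rw [← Real.mul_rpow (by positivity) hw]
    exact Real.rpow_le_rpow (abs_nonneg _) (hD.trans h) hq.le
  have hsplit : ∀ c : ℝ, t ^ c / t ^ ((n : ℝ) + s * q) = t ^ (c - (n + s * q)) := fun c =>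
    (Real.rpow_sub ht0 _ _).symm
  rcases le_or_gt t (r / 2) with htr | htr
  · have h1 := key (t / r) (by positivity)
      ((abs_log_log_sub_le_of_near her her' hrt htr).trans (by gcongr))
    calc _ ≤ (M / L) ^ q * (t / r) ^ q / t ^ ((n : ℝ) + s * q) := by gcongr
      _ = (M / L) ^ q *
          (r ^ (-q) * (Iic (r / 2)).indicator (fun t => t ^ (q * (1 - s) - n)) t) := by
        rw [indicator_of_mem (show t ∈ Iic (r / 2) from htr), Real.div_rpow ht0.le hr0.le,
          Real.rpow_neg hr0.le, show q * (1 - s) - n = q - (n + s * q) by ring, ← hsplit]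
        field_simp
      _ ≤ _ := by
        gcongr
        rw [add_assoc]
        exact le_add_of_nonneg_right (by positivity)
  rcases le_or_gt r r' with hrr' | hrr'
  · have h1 := key ((t / r) ^ ε) (by positivity)
      ((abs_log_log_sub_le_of_le her hrr' hrt htr hε).trans (by gcongr))
    rw [← Real.rpow_mul (by positivity)] at h1
    calc _ ≤ (M / L) ^ q * (t / r) ^ (ε * q) / t ^ ((n : ℝ) + s * q) := by gcongr
      _ = (M / L) ^ q * (r ^ (-(ε * q)) *
          (Ioi (r / 2)).indicator (fun t => t ^ (-((s - ε) * q) - n)) t) := by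
        rw [indicator_of_mem (show t ∈ Ioi (r / 2) from htr), Real.div_rpow ht0.le hr0.le,
          Real.rpow_neg hr0.le, show -((s - ε) * q) - n = ε * q - (n + s * q) by ring, ← hsplit]
        field_simp
      _ ≤ _ := by
        gcongr
        rw [add_right_comm]
        exact le_add_of_nonneg_left (by positivity)
  · have h1 := key ((r / r') ^ ε) (by positivity)
      ((abs_log_log_sub_le_of_ge her' hrr'.le hε).trans (by gcongr))
    rw [← Real.rpow_mul (by positivity)] at h1
    have hyr : ‖y‖ ≤ r := by linarith [Real.exp_pos 1]
    calc _ ≤ (M / L) ^ q * (r / ‖y‖) ^ (ε * q) / (r / 2) ^ ((n : ℝ) + s * q) := by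
          refine div_le_div₀ (by positivity) (h1.trans ?_) (by positivity) (by gcongr)
          gcongr
          linarith [Real.exp_pos 1]
      _ = (M / L) ^ q * (2 ^ (n + s * q) * r ^ (ε * q - n - s * q) *
          (Iic r).indicator (fun t => t ^ ((n - ε * q) - n)) ‖y‖) := by
        rw [indicator_of_mem (show ‖y‖ ∈ Iic r from hyr), Real.div_rpow hr0.le hy0.le,
          Real.div_rpow hr0.le (by norm_num), show (n - ε * q) - n = -(ε * q) by ring,
          Real.rpow_neg hy0.le, sub_sub, Real.rpow_sub hr0]
        field_simp
      _ ≤ _ := by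
        gcongr
        exact le_add_of_nonneg_left (by positivity)

lemma lintegral_const_mul_indicator_norm_le {n : ℕ} {S : Set ℝ} {c b A : ℝ} (hc : 0 ≤ c)
    (h : ∫⁻ z : EuclideanSpace ℝ (Fin n),
      ENNReal.ofReal (S.indicator (fun t => t ^ b) ‖z‖) ≤ ENNReal.ofReal A) :
    ∫⁻ z : EuclideanSpace ℝ (Fin n), ENNReal.ofReal (c * S.indicator (fun t => t ^ b) ‖z‖) ≤
      ENNReal.ofReal (c * A) := by
  simp_rw [ENNReal.ofReal_mul hc]
  rw [lintegral_const_mul' _ _ ENNReal.ofReal_ne_top]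
  gcongr

lemma exists_lintegral_slowOsc_quotient_le {n : ℕ} (hn : 1 ≤ n) {s q : ℝ} (hs0 : 0 < s)
    (hs1 : s < 1) (hq : 0 < q) :
    ∃ C : ℝ, 0 ≤ C ∧ ∀ x : EuclideanSpace ℝ (Fin n),
      ∫⁻ y, ENNReal.ofReal
        (|slowOsc n x - slowOsc n y| ^ q / ‖x - y‖ ^ ((n : ℝ) + s * q)) ≤
      ENNReal.ofReal (C * (Real.log (Real.exp 1 + ‖x‖) ^ (-q) *
        (Real.exp 1 + ‖x‖) ^ (-(s * q)))) := by
  obtain ⟨ε, hε, hε'⟩ : ∃ ε : ℝ, 0 < ε ∧ ε < min s (1 / q) :=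
    exists_between (lt_min hs0 (by positivity))
  have hεs : ε < s := hε'.trans_le (min_le_left _ _)
  have hεq : ε * q < 1 := (lt_div_iff₀ hq).1 (hε'.trans_le (min_le_right _ _))
  have hn' : (1 : ℝ) ≤ n := by exact_mod_cast hn
  obtain ⟨K₁, hK₁, h₁⟩ := exists_lintegral_ball_rpow_le hn (b := q * (1 - s))
    (mul_pos hq (by linarith))
  obtain ⟨K₂, hK₂, h₂⟩ := exists_lintegral_compl_ball_rpow_le hn (b := (s - ε) * q)
    (mul_pos (by linarith) hq)
  obtain ⟨K₃, hK₃, h₃⟩ := exists_lintegral_ball_rpow_le hn (b := n - ε * q) (by linarith)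
  set M := 8 + 3 ^ ε / ε + 2 / ε * (1 + 2 / ε) with hM
  have hM0 : 0 ≤ M := by positivity
  refine ⟨M ^ q * (K₁ * 2 ^ (-(q * (1 - s))) + K₂ * 2 ^ ((s - ε) * q) +
    2 ^ (n + s * q) * K₃), by positivity, fun x => ?_⟩
  obtain ⟨r, hr⟩ : ∃ r, r = Real.exp 1 + ‖x‖ := ⟨_, rfl⟩
  rw [← hr]
  have her : Real.exp 1 ≤ r := by linarith [norm_nonneg x]
  have hr0 : 0 < r := (Real.exp_pos 1).trans_le her
  have hL : 0 < Real.log r := by linarith [one_le_log_of_exp_one_le her]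
  have hML : 0 ≤ (M / Real.log r) ^ q := by positivity
  have : NeZero n := ⟨by omega⟩
  have hae : ∀ᵐ y : EuclideanSpace ℝ (Fin n), y ≠ 0 := by
    simp [ae_iff, measure_singleton]
  set c₁ := r ^ (-q) with hc₁
  set c₂ := r ^ (-(ε * q)) with hc₂
  set c₃ := 2 ^ (n + s * q) * r ^ (ε * q - n - s * q) with hc₃
  have hc₁0 : 0 ≤ c₁ := by positivity
  have hc₂0 : 0 ≤ c₂ := by positivity
  have hc₃0 : 0 ≤ c₃ := by positivity
  have H₁ := lintegral_const_mul_indicator_norm_le hc₁0 (h₁ (r / 2) (by positivity))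
  have H₂ := lintegral_const_mul_indicator_norm_le hc₂0 (h₂ (r / 2) (by positivity))
  have H₃ := lintegral_const_mul_indicator_norm_le hc₃0 (h₃ r hr0)
  rw [← lintegral_sub_left_eq_self _ x] at H₁ H₂
  have hm₁ : Measurable ((Iic (r / 2)).indicator fun t : ℝ => t ^ (q * (1 - s) - n)) :=
    Measurable.indicator (by fun_prop) measurableSet_Iic
  have hm₂ : Measurable ((Ioi (r / 2)).indicator fun t : ℝ => t ^ (-((s - ε) * q) - n)) :=
    Measurable.indicator (by fun_prop) measurableSet_Ioi
  set f₁ := (Iic (r / 2)).indicator fun t : ℝ => t ^ (q * (1 - s) - n) with hf₁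
  set f₂ := (Ioi (r / 2)).indicator fun t : ℝ => t ^ (-((s - ε) * q) - n) with hf₂
  set f₃ := (Iic r).indicator fun t : ℝ => t ^ ((n - ε * q) - n) with hf₃
  have hf₁0 : ∀ z : EuclideanSpace ℝ (Fin n), 0 ≤ f₁ ‖z‖ := fun z =>
    indicator_apply_nonneg fun _ => by positivity
  have hf₂0 : ∀ z : EuclideanSpace ℝ (Fin n), 0 ≤ f₂ ‖z‖ := fun z =>
    indicator_apply_nonneg fun _ => by positivity
  have hf₃0 : ∀ z : EuclideanSpace ℝ (Fin n), 0 ≤ f₃ ‖z‖ := fun z =>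
    indicator_apply_nonneg fun _ => by positivity
  calc _ ≤ ∫⁻ y, ENNReal.ofReal ((M / Real.log r) ^ q *
          (c₁ * f₁ ‖x - y‖ + c₂ * f₂ ‖x - y‖ + c₃ * f₃ ‖y‖)) := by
        refine lintegral_mono_ae (hae.mono fun y hy => ENNReal.ofReal_le_ofReal ?_)
        exact slowOsc_quotient_le hs0 hq hε hr hy
    _ = ENNReal.ofReal ((M / Real.log r) ^ q) *
          ((∫⁻ y, ENNReal.ofReal (c₁ * f₁ ‖x - y‖)) + (∫⁻ y, ENNReal.ofReal (c₂ * f₂ ‖x - y‖)) +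
            ∫⁻ y : EuclideanSpace ℝ (Fin n), ENNReal.ofReal (c₃ * f₃ ‖y‖)) := by
        have hg₁ : Measurable fun y : EuclideanSpace ℝ (Fin n) =>
            ENNReal.ofReal (c₁ * f₁ ‖x - y‖) := by fun_prop
        have hg₂ : Measurable fun y : EuclideanSpace ℝ (Fin n) =>
            ENNReal.ofReal (c₂ * f₂ ‖x - y‖) := by fun_prop
        rw [← lintegral_add_left hg₁, ← lintegral_add_left (hg₁.fun_add hg₂),
          ← lintegral_const_mul' _ _ ENNReal.ofReal_ne_top]
        refine lintegral_congr fun y => ?_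
        have e₁ := mul_nonneg hc₁0 (hf₁0 (x - y))
        have e₂ := mul_nonneg hc₂0 (hf₂0 (x - y))
        have e₃ := mul_nonneg hc₃0 (hf₃0 y)
        rw [ENNReal.ofReal_mul hML, ENNReal.ofReal_add (add_nonneg e₁ e₂) e₃,
          ENNReal.ofReal_add e₁ e₂]
    _ ≤ ENNReal.ofReal ((M / Real.log r) ^ q) *
          (ENNReal.ofReal (c₁ * (K₁ * (r / 2) ^ (q * (1 - s)))) +
            ENNReal.ofReal (c₂ * (K₂ * (r / 2) ^ (-((s - ε) * q)))) +
            ENNReal.ofReal (c₃ * (K₃ * r ^ (n - ε * q)))) := by gcongr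
    _ = _ := by
        rw [← ENNReal.ofReal_add (by positivity) (by positivity),
          ← ENNReal.ofReal_add (by positivity) (by positivity), ← ENNReal.ofReal_mul hML]
        congr 1
        have a₁ : c₁ * (K₁ * (r / 2) ^ (q * (1 - s))) =
            K₁ * 2 ^ (-(q * (1 - s))) * r ^ (-(s * q)) := by
          rw [hc₁, Real.div_rpow hr0.le (by norm_num), Real.rpow_neg zero_le_two,
            show -(s * q) = -q + q * (1 - s) by ring, Real.rpow_add hr0]
          field_simp
        have a₂ : c₂ * (K₂ * (r / 2) ^ (-((s - ε) * q))) =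
            K₂ * 2 ^ ((s - ε) * q) * r ^ (-(s * q)) := by
          rw [hc₂, Real.div_rpow hr0.le (by norm_num), Real.rpow_neg zero_le_two,
            show -(s * q) = -(ε * q) + -((s - ε) * q) by ring, Real.rpow_add hr0]
          field_simp
        have a₃ : c₃ * (K₃ * r ^ (n - ε * q)) =
            2 ^ (n + s * q) * K₃ * r ^ (-(s * q)) := by
          rw [hc₃, show -(s * q) = (ε * q - n - s * q) + (n - ε * q) by ring, Real.rpow_add hr0]
          ring
        rw [a₁, a₂, a₃, Real.div_rpow hM0 hL.le, Real.rpow_neg hL.le]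
        ring

lemma fracEnergy_slowOsc_lt_top {n : ℕ} (hn : 2 ≤ n) {s p q : ℝ} (hs0 : 0 < s) (hs1 : s < 1)
    (hp : 0 < p) (hq : 0 < q) (hspn : (n : ℝ) ≤ s * p) :
    fracEnergy n s p q (slowOsc n) < ⊤ := by
  have hn' : (2 : ℝ) ≤ n := by exact_mod_cast hn
  have hp1 : 1 < p := by nlinarith
  obtain ⟨C, hC, h⟩ := exists_lintegral_slowOsc_quotient_le (n := n) (by omega) hs0 hs1 hq
  calc fracEnergy n s p q (slowOsc n)
      ≤ ∫⁻ x : EuclideanSpace ℝ (Fin n), ENNReal.ofReal (C ^ (p / q)) * ENNReal.ofReal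
          ((Real.exp 1 + ‖x‖) ^ (-(n : ℝ)) * Real.log (Real.exp 1 + ‖x‖) ^ (-p)) := by
        refine lintegral_mono fun x => ?_
        obtain ⟨r, hr⟩ : ∃ r, r = Real.exp 1 + ‖x‖ := ⟨_, rfl⟩
        have her : Real.exp 1 ≤ r := by linarith [norm_nonneg x]
        have hr1 : 1 ≤ r := by linarith [Real.add_one_le_exp (1 : ℝ)]
        have hL : 0 < Real.log r := by linarith [one_le_log_of_exp_one_le her]
        have hx := h x
        rw [← hr] at hx ⊢
        refine (ENNReal.rpow_le_rpow hx (by positivity)).trans ?_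
        rw [ENNReal.ofReal_rpow_of_nonneg (by positivity) (by positivity),
          ← ENNReal.ofReal_mul (by positivity)]
        apply ENNReal.ofReal_le_ofReal
        rw [Real.mul_rpow hC (by positivity), Real.mul_rpow (by positivity) (by positivity),
          ← Real.rpow_mul hL.le, ← Real.rpow_mul (by positivity),
          show -q * (p / q) = -p by field_simp, show -(s * q) * (p / q) = -(s * p) by field_simp,
          mul_comm (Real.log r ^ (-p))]
        gcongr
    _ < ⊤ := by
        rw [lintegral_const_mul' _ _ ENNReal.ofReal_ne_top]
        exact ENNReal.mul_lt_top ENNReal.ofReal_lt_top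
          (lintegral_log_weight_lt_top (by omega) hp1)

lemma frequently_eq_of_continuousOn_of_tendsto_atTop {g : ℝ → ℝ} (hg : ContinuousOn g (Ici 0))
    (htop : Tendsto g atTop atTop) {c : ℕ → ℝ} (hc : Tendsto c atTop atTop) :
    ∃ᶠ t in atTop, ∃ k, g t = c k := by
  rw [frequently_atTop]
  intro a
  obtain ⟨k, hk⟩ := (hc.eventually_ge_atTop (g (max a 0))).exists
  obtain ⟨b, hb, hb'⟩ := ((htop.eventually_ge_atTop (c k)).and
    (eventually_ge_atTop (max a 0))).exists
  obtain ⟨t, ht, hgt⟩ := intermediate_value_Icc hb'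
    (hg.mono fun t ht => (le_max_right a 0).trans ht.1) ⟨hk, hb⟩
  exact ⟨t, (le_max_left a 0).trans ht.1, k, hgt⟩

lemma tendsto_add_natCast_mul_two_pi (a : ℝ) :
    Tendsto (fun k : ℕ => a + k * (2 * Real.pi)) atTop atTop :=
  tendsto_atTop_add_const_left _ _
    (tendsto_natCast_atTop_atTop.atTop_mul_const Real.two_pi_pos)

lemma not_tendsto_sin_comp {g : ℝ → ℝ} (hg : ContinuousOn g (Ici 0))
    (htop : Tendsto g atTop atTop) (L : ℝ) :
    ¬ Tendsto (fun t => Real.sin (g t)) atTop (nhds L) := by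
  intro h
  have key : ∀ a : ℝ, L = Real.sin a := fun a => by
    have hfreq : ∃ᶠ t in atTop, Real.sin (g t) ∈ ({Real.sin a} : Set ℝ) :=
      (frequently_eq_of_continuousOn_of_tendsto_atTop hg htop
        (tendsto_add_natCast_mul_two_pi a)).mono fun t ⟨k, hk⟩ => by
          rw [hk, Real.sin_add_nat_mul_two_pi]
          rfl
    simpa using isClosed_singleton.mem_of_frequently_of_tendsto hfreq h
  have h0 := key 0
  have h1 := key (Real.pi / 2)
  rw [h0, Real.sin_zero, Real.sin_pi_div_two] at h1
  exact zero_ne_one h1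

theorem stmt9 (n : ℕ) (hn : 2 ≤ n) (s p q : ℝ) (hs0 : 0 < s) (hs1 : s < 1)
    (hp : 0 < p) (hq : 0 < q) (hspn : (n : ℝ) ≤ s * p) :
    ∃ u : EuclideanSpace ℝ (Fin n) → ℝ, Continuous u ∧ (∃ C : ℝ, ∀ x, |u x| ≤ C) ∧ MemHomFrac n s p q u ∧
      ∀ γ : ℝ → EuclideanSpace ℝ (Fin n), ContinuousOn γ (Set.Ici 0) → γ 0 = 0 →
        Filter.Tendsto (fun t => ‖γ t‖) Filter.atTop Filter.atTop →
        ∀ L : ℝ, ¬ Filter.Tendsto (fun t => u (γ t)) Filter.atTop (nhds L) := by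
  refine ⟨slowOsc n, continuous_slowOsc n, ⟨1, fun x => Real.abs_sin_le_one _⟩,
    ⟨(continuous_slowOsc n).measurable, fracEnergy_slowOsc_lt_top hn hs0 hs1 hp hq hspn⟩, ?_⟩
  intro γ hγ _ htop L
  exact not_tendsto_sin_comp ((continuous_log_log_add_norm n).comp_continuousOn hγ)
    (Real.tendsto_log_atTop.comp (Real.tendsto_log_atTop.comp
      (tendsto_atTop_add_const_left _ _ htop))) L

end
end
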